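/- A move M : X × X → ℝ is the difference of two couplings γ, γ̄ ∈ P(μ, ν) if and only if ∑_y |M(x,y)| ≤ 2μ(x) for all x and ∑_x |M(x,y)| ≤ 2ν(y) for all y. -/

import Mathlib

def IsCoupling {X : Type*} [Fintype X] (μ ν : X → ℝ) (γ : X → X → ℝ) : Prop :=
  (∀ x y, 0 ≤ γ x y) ∧ (∀ x, ∑ y, γ x y = μ x) ∧ (∀ y, ∑ x, γ x y = ν y)

/-- Two nonnegative functions with equal total mass have a coupling. -/
theorem exists_isCoupling_of_sum_eq {X : Type*} [Fintype X] {a b : X → ℝ}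
    (ha : ∀ x, 0 ≤ a x) (hb : ∀ y, 0 ≤ b y) (h : ∑ x, a x = ∑ y, b y) :
    ∃ γ, IsCoupling a b γ := by
  have hs : 0 ≤ ∑ y, b y := Finset.sum_nonneg fun y _ => hb y
  refine ⟨fun x y => a x * b y / ∑ z, b z,
    fun x y => div_nonneg (mul_nonneg (ha x) (hb y)) hs, fun x => ?_, fun y => ?_⟩
  · rw [← Finset.sum_div, ← Finset.mul_sum]
    by_cases h0 : ∑ z, b z = 0
    · have := (Finset.sum_eq_zero_iff_of_nonneg fun x _ => ha x).1 (h.trans h0) x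
        (Finset.mem_univ x)
      simp [this]
    · exact mul_div_cancel_right₀ _ h0
  · rw [← Finset.sum_div, ← Finset.sum_mul, h]
    by_cases h0 : ∑ z, b z = 0
    · have := (Finset.sum_eq_zero_iff_of_nonneg fun y _ => hb y).1 h0 y (Finset.mem_univ y)
      simp [this]
    · exact mul_div_cancel_left₀ _ h0

/-- A move `M` (zero row and column sums) is a difference of two couplings in
`P(μ, ν)` iff `∑_y |M(x,y)| ≤ 2μ(x)` for all `x` and `∑_x |M(x,y)| ≤ 2ν(y)` for all `y`. -/
theorem move_is_difference_of_couplings_iff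
    {X : Type*} [Fintype X] (μ ν : X → ℝ)
    (hμ0 : ∀ x, 0 ≤ μ x) (hμ1 : ∑ x, μ x = 1)
    (hν0 : ∀ x, 0 ≤ ν x) (hν1 : ∑ x, ν x = 1)
    (M : X → X → ℝ)
    (hrow : ∀ x, ∑ y, M x y = 0) (hcol : ∀ y, ∑ x, M x y = 0) :
    (∃ γ γ' : X → X → ℝ, IsCoupling μ ν γ ∧ IsCoupling μ ν γ' ∧
        ∀ x y, M x y = γ x y - γ' x y) ↔
      ((∀ x, ∑ y, |M x y| ≤ 2 * μ x) ∧ (∀ y, ∑ x, |M x y| ≤ 2 * ν y)) := by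
  constructor
  · rintro ⟨γ, γ', ⟨h0, hr, hc⟩, ⟨h0', hr', hc'⟩, hM⟩
    have key : ∀ x y, |M x y| ≤ γ x y + γ' x y := fun x y => by
      rw [hM, abs_le]
      constructor <;> linarith [h0 x y, h0' x y]
    constructor
    · intro x
      calc ∑ y, |M x y| ≤ ∑ y, (γ x y + γ' x y) := Finset.sum_le_sum fun y _ => key x y
        _ = 2 * μ x := by rw [Finset.sum_add_distrib, hr, hr', two_mul]
    · intro y
      calc ∑ x, |M x y| ≤ ∑ x, (γ x y + γ' x y) := Finset.sum_le_sum fun x _ => key x y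
        _ = 2 * ν y := by rw [Finset.sum_add_distrib, hc, hc', two_mul]
  · rintro ⟨hr, hc⟩
    obtain ⟨R, hR0, hRr, hRc⟩ := exists_isCoupling_of_sum_eq
      (a := fun x => μ x - (∑ y, |M x y|) / 2) (b := fun y => ν y - (∑ x, |M x y|) / 2)
      (fun x => by linarith [hr x]) (fun y => by linarith [hc y])
      (by
        rw [Finset.sum_sub_distrib, Finset.sum_sub_distrib, hμ1, hν1, ← Finset.sum_div,
          ← Finset.sum_div, Finset.sum_comm])
    refine ⟨fun x y => (|M x y| + M x y) / 2 + R x y, fun x y => (|M x y| - M x y) / 2 + R x y,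
      ⟨fun x y => ?_, fun x => ?_, fun y => ?_⟩, ⟨fun x y => ?_, fun x => ?_, fun y => ?_⟩,
      fun x y => by ring⟩
    · linarith [neg_abs_le (M x y), hR0 x y]
    · rw [Finset.sum_add_distrib, ← Finset.sum_div, Finset.sum_add_distrib, hrow, hRr]
      ring
    · rw [Finset.sum_add_distrib, ← Finset.sum_div, Finset.sum_add_distrib, hcol, hRc]
      ring
    · linarith [le_abs_self (M x y), hR0 x y]
    · rw [Finset.sum_add_distrib, ← Finset.sum_div, Finset.sum_sub_distrib, hrow, hRr]
      ring
    · rw [Finset.sum_add_distrib, ← Finset.sum_div, Finset.sum_sub_distrib, hcol, hRc]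
      ring
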